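/- arXiv:1409.5966 — 3 statements merged into one kernel-verified Lean document; each statement's English description precedes it below -/
import Mathlib

section
/- Let a, b, c, d, e, f, g be complex numbers satisfying e+f+g = a+b+c+d+1. Then S(g−a, f−b, f−c, f−d) − S(f−a, g−b, g−c, g−d) = S(f−g)·(S(b−a, c−a, d−a) + S(e−2a, f−a, g−a)). -/
open Complex

/-- `S x = sin (π x)` for complex `x`. -/
noncomputable def Sn (x : ℂ) : ℂ := Complex.sin ((Real.pi : ℂ) * x)

/-- The addition-formula core of the identity, with all angles measured from a common origin. -/
theorem sin_four_product_identity (B C D F G : ℂ) :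
    sin G * sin (F - B) * sin (F - C) * sin (F - D) -
      sin F * sin (G - B) * sin (G - C) * sin (G - D) =
    sin (F - G) * (sin B * sin C * sin D + sin (F + G - B - C - D) * sin F * sin G) := by
  simp only [Complex.sin, neg_mul, sub_mul, add_mul, exp_neg, exp_sub, exp_add]
  have hB := exp_ne_zero (B * I)
  have hC := exp_ne_zero (C * I)
  have hD := exp_ne_zero (D * I)
  have hF := exp_ne_zero (F * I)
  have hG := exp_ne_zero (G * I)
  generalize exp (B * I) = u at *
  generalize exp (C * I) = v at *
  generalize exp (D * I) = w at *
  generalize exp (F * I) = x at *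
  generalize exp (G * I) = y at *
  field_simp
  ring

theorem sine_product_saalschutz_identity (a b c d e f g : ℂ)
    (hsaal : e + f + g = a + b + c + d + 1) :
    Sn (g - a) * Sn (f - b) * Sn (f - c) * Sn (f - d) -
      Sn (f - a) * Sn (g - b) * Sn (g - c) * Sn (g - d) =
    Sn (f - g) * (Sn (b - a) * Sn (c - a) * Sn (d - a) +
      Sn (e - 2 * a) * Sn (f - a) * Sn (g - a)) := by
  have he : e - 2 * a = 1 - ((f - a) + (g - a) - (b - a) - (c - a) - (d - a)) := by
    linear_combination hsaal
  have hsin : Sn (e - 2 * a) = Sn ((f - a) + (g - a) - (b - a) - (c - a) - (d - a)) := by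
    rw [he, Sn, mul_sub, mul_one, Complex.sin_pi_sub, Sn]
  rw [hsin]
  have key := sin_four_product_identity (Real.pi * (b - a)) (Real.pi * (c - a))
    (Real.pi * (d - a)) (Real.pi * (f - a)) (Real.pi * (g - a))
  simp only [← mul_sub, ← mul_add, sub_sub_sub_cancel_right] at key
  simpa only [Sn, sub_sub_sub_cancel_right] using key
end

section
/- Let S(L²) denote the set of two-element subsets of G_L\M, on which M acts elementwise by right multiplication. Then the diagonal action of M on (G_K\M) × S(L²) has exactly four orbits, and the multiset of orbit sizes is {480, 960, 192, 480}. -/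
open Matrix MulAction Pointwise

noncomputable section

namespace KLPaper

/-- The permutation matrix of the transposition (1 2), over `ℤ`. -/
def t12 : Matrix (Fin 7) (Fin 7) ℤ :=
  !![0,1,0,0,0,0,0; 1,0,0,0,0,0,0; 0,0,1,0,0,0,0; 0,0,0,1,0,0,0;
     0,0,0,0,1,0,0; 0,0,0,0,0,1,0; 0,0,0,0,0,0,1]

def t23 : Matrix (Fin 7) (Fin 7) ℤ :=
  !![1,0,0,0,0,0,0; 0,0,1,0,0,0,0; 0,1,0,0,0,0,0; 0,0,0,1,0,0,0;
     0,0,0,0,1,0,0; 0,0,0,0,0,1,0; 0,0,0,0,0,0,1]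

def t34 : Matrix (Fin 7) (Fin 7) ℤ :=
  !![1,0,0,0,0,0,0; 0,1,0,0,0,0,0; 0,0,0,1,0,0,0; 0,0,1,0,0,0,0;
     0,0,0,0,1,0,0; 0,0,0,0,0,1,0; 0,0,0,0,0,0,1]

def t56 : Matrix (Fin 7) (Fin 7) ℤ :=
  !![1,0,0,0,0,0,0; 0,1,0,0,0,0,0; 0,0,1,0,0,0,0; 0,0,0,1,0,0,0;
     0,0,0,0,0,1,0; 0,0,0,0,1,0,0; 0,0,0,0,0,0,1]

def t67 : Matrix (Fin 7) (Fin 7) ℤ :=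
  !![1,0,0,0,0,0,0; 0,1,0,0,0,0,0; 0,0,1,0,0,0,0; 0,0,0,1,0,0,0;
     0,0,0,0,1,0,0; 0,0,0,0,0,0,1; 0,0,0,0,0,1,0]

/-- The matrix `A` of the paper. -/
def tA : Matrix (Fin 7) (Fin 7) ℤ :=
  !![1,0,0,0,0,0,0; 0,1,0,0,0,0,0; 0,0,-1,0,0,0,1; 0,0,0,-1,0,0,1;
     0,0,-1,-1,1,0,1; 0,0,-1,-1,0,1,1; 0,0,0,0,0,0,1]

/-- An integral involution, viewed as an element of `GL (Fin 7) ℂ`. -/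
def toGL (A : Matrix (Fin 7) (Fin 7) ℤ) (h : A * A = 1) : GL (Fin 7) ℂ where
  val := A.map (Int.castRingHom ℂ)
  inv := A.map (Int.castRingHom ℂ)
  val_inv := by
    rw [← Matrix.map_mul, h]
    exact Matrix.map_one _ (by simp) (by simp)
  inv_val := by
    rw [← Matrix.map_mul, h]
    exact Matrix.map_one _ (by simp) (by simp)

def g12 : GL (Fin 7) ℂ := toGL t12 (by decide)
def g23 : GL (Fin 7) ℂ := toGL t23 (by decide)
def g34 : GL (Fin 7) ℂ := toGL t34 (by decide)
def g56 : GL (Fin 7) ℂ := toGL t56 (by decide)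
def g67 : GL (Fin 7) ℂ := toGL t67 (by decide)
def gA : GL (Fin 7) ℂ := toGL tA (by decide)

/-- The group `M ≅ W(D₆)`. -/
def Mgp : Subgroup (GL (Fin 7) ℂ) := Subgroup.closure {g12, g23, g34, g56, g67, gA}

/-- The invariance group `G_K ≅ S₆` of the function `K`. -/
def GKgp : Subgroup (GL (Fin 7) ℂ) := Subgroup.closure {g23, g34, g56, g67, gA}

/-- The invariance group `G_L ≅ W(D₅)` of the function `L`. -/
def GLgp : Subgroup (GL (Fin 7) ℂ) := Subgroup.closure {g12, g23, g34, g67, gA}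

/-- The space of right cosets `H\G`. -/
abbrev RQ {G : Type*} [Group G] (H : Subgroup G) := Quotient (QuotientGroup.rightRel H)

/-- `G` acts on the right coset space `H\G` by right multiplication;
as usual a right action of `G` is rendered as a (left) action of `Gᵐᵒᵖ`. -/
instance rqAction {G : Type*} [Group G] (H : Subgroup G) : MulAction Gᵐᵒᵖ (RQ H) where
  smul g := Quotient.map (fun x => x * g.unop) (by
    intro x y hxy
    have h' := QuotientGroup.rightRel_apply.mp hxy
    exact QuotientGroup.rightRel_apply.mpr
      (by simpa [_root_.mul_inv_rev, mul_assoc] using h'))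
  one_smul q := Quotient.inductionOn q (fun x =>
    Quotient.sound (QuotientGroup.rightRel_apply.mpr (by simp [H.one_mem])))
  mul_smul g h q := Quotient.inductionOn q (fun x =>
    Quotient.sound (QuotientGroup.rightRel_apply.mpr (by simp [_root_.mul_inv_rev, mul_assoc, H.one_mem])))

/-- The elementwise action on finite subsets of fixed cardinality. -/
instance ncardAction {G X : Type*} [Group G] [MulAction G X] (k : ℕ) :
    MulAction G {s : Set X // s.ncard = k} where
  smul g s := ⟨g • (s : Set X), by rw [Set.ncard_smul_set]; exact s.2⟩
  one_smul s := Subtype.ext (one_smul G (s : Set X))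
  mul_smul g h s := Subtype.ext (mul_smul g h (s : Set X))

/-- The right coset space `G_K\M`. -/
abbrev RCK := RQ (GKgp.subgroupOf Mgp)

/-- The right coset space `G_L\M`. -/
abbrev RCL := RQ (GLgp.subgroupOf Mgp)

/-- The simple reflections of `M` in the order of the Dynkin diagram of type `D₆`: the nodes
`0, …, 4` form a chain and the node `5` is attached to the node `3`. The generator `gA` is not a
reflection, but its product with `g34` is. -/
def gen : Fin 6 → GL (Fin 7) ℂ := ![g56, g67, gA * g34, g23, g34, g12]

def genInt : Fin 6 → Matrix (Fin 7) (Fin 7) ℤ := ![t56, t67, tA * t34, t23, t34, t12]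

/-- The product of the generators along a word. -/
def wordProd (w : List (Fin 6)) : GL (Fin 7) ℂ := (w.map gen).prod

/-- The `12` signed coordinate vectors; the second component is `true` for a minus sign. -/
abbrev SignedIndex := Fin 6 × Bool

/-- The generators of `W(D₆)` acting on signed coordinate vectors. -/
def reflect (s : Fin 6) (x : SignedIndex) : SignedIndex :=
  if s = 5 then (Equiv.swap 4 5 x.1, xor x.2 (decide (4 ≤ x.1)))
  else (Equiv.swap s (s + 1) x.1, x.2)

/-- The generators of `W(D₆)` acting on sign patterns. -/
def reflectSigns (s : Fin 6) (ε : Fin 6 → Bool) : Fin 6 → Bool := fun k =>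
  if s = 5 then xor (ε (Equiv.swap 4 5 k)) (decide (4 ≤ k)) else ε (Equiv.swap s (s + 1) k)

/-- The sign patterns with an even number of minus signs, i.e. the weights of a half-spin
representation of type `D₆`. -/
abbrev HalfSpin := {ε : Fin 6 → Bool // Even (Finset.univ.filter fun k => ε k = true).card}

def reflectSpin (s : Fin 6) (ε : HalfSpin) : HalfSpin :=
  ⟨reflectSigns s ε.1, by
    have h : ∀ (s : Fin 6) (ε : Fin 6 → Bool),
        Even (Finset.univ.filter fun k => ε k = true).card →
        Even (Finset.univ.filter fun k => reflectSigns s ε k = true).card := by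
      decide +kernel
    exact h s ε.1 ε.2⟩

/-- The right action of words in the generators, given the action of each generator. -/
def actWord {X : Type*} (f : Fin 6 → X → X) (w : List (Fin 6)) (x : X) : X :=
  w.foldl (fun y s => f s y) x

@[simp] lemma actWord_nil {X : Type*} (f : Fin 6 → X → X) (x : X) : actWord f [] x = x := rfl

@[simp] lemma actWord_cons {X : Type*} (f : Fin 6 → X → X) (s : Fin 6) (w : List (Fin 6)) (x : X) :
    actWord f (s :: w) x = actWord f w (f s x) := rfl

@[simp] lemma actWord_append {X : Type*} (f : Fin 6 → X → X) (v w : List (Fin 6)) (x : X) :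
    actWord f (v ++ w) x = actWord f w (actWord f v x) := List.foldl_append ..

lemma actWord_injective {X : Type*} {f : Fin 6 → X → X} (hf : ∀ s, Function.Injective (f s))
    (w : List (Fin 6)) : Function.Injective (actWord f w) := by
  induction w with
  | nil => exact Function.injective_id
  | cons s w ih => exact ih.comp (hf s)

@[simp] lemma wordProd_nil : wordProd [] = 1 := rfl

@[simp] lemma wordProd_append (v w : List (Fin 6)) :
    wordProd (v ++ w) = wordProd v * wordProd w := by
  simp [wordProd]

@[simp] lemma wordProd_cons (s : Fin 6) (w : List (Fin 6)) :
    wordProd (s :: w) = gen s * wordProd w := by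
  simp [wordProd]

lemma gen_val (s : Fin 6) : (gen s).val = (genInt s).map (Int.castRingHom ℂ) := by
  fin_cases s <;> first | exact (Matrix.map_mul (f := Int.castRingHom ℂ)).symm | rfl

lemma gen_mul_self (s : Fin 6) : gen s * gen s = 1 := by
  have h : ∀ s, genInt s * genInt s = 1 := by decide +kernel
  ext1
  rw [Units.val_mul, gen_val, ← Matrix.map_mul, h]
  exact Matrix.map_one _ (by simp) (by simp)

lemma gen_inv (s : Fin 6) : (gen s)⁻¹ = gen s := inv_eq_of_mul_eq_one_left (gen_mul_self s)

/-- The rows `0, …, 5` are vectors permuted by `M` up to sign, and the last row is fixed by `M`. -/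
def coordRows : Matrix (Fin 7) (Fin 7) ℤ :=
  !![-1,-1,-1,-1,2,0,0; -1,-1,-1,-1,0,2,0; -1,-1,-1,-1,0,0,2; -1,-1,1,1,0,0,0;
     -1,1,-1,1,0,0,0; -1,1,1,-1,0,0,0; 1,1,1,1,-1,-1,-1]

/-- Four times the inverse of `coordRows`. -/
def coordRowsInv : Matrix (Fin 7) (Fin 7) ℤ :=
  !![-1,-1,-1,-1,-1,-1,-2; -1,-1,-1,-1,1,1,-2; -1,-1,-1,1,-1,1,-2; -1,-1,-1,1,1,-1,-2;
     0,-2,-2,0,0,0,-4; -2,0,-2,0,0,0,-4; -2,-2,0,0,0,0,-4]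

def signedRow (x : SignedIndex) : Fin 7 → ℤ :=
  if x.2 then -coordRows x.1.castSucc else coordRows x.1.castSucc

def signedRowC (x : SignedIndex) : Fin 7 → ℂ := fun k => (signedRow x k : ℂ)

lemma intCast_vecMul (v : Fin 7 → ℤ) (A : Matrix (Fin 7) (Fin 7) ℤ) :
    (fun k => (v k : ℂ)) ᵥ* A.map (Int.castRingHom ℂ) = fun k => ((v ᵥ* A) k : ℂ) := by
  ext k
  simp [Matrix.vecMul, dotProduct]

lemma signedRowC_vecMul_gen (x : SignedIndex) (s : Fin 6) :
    signedRowC x ᵥ* (gen s).val = signedRowC (reflect s x) := by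
  have h : ∀ x s, signedRow x ᵥ* genInt s = signedRow (reflect s x) := by decide +kernel
  rw [gen_val]
  exact (intCast_vecMul _ _).trans (by rw [h]; rfl)

lemma fixedRow_vecMul_gen (s : Fin 6) :
    (fun k => (coordRows 6 k : ℂ)) ᵥ* (gen s).val = fun k => (coordRows 6 k : ℂ) := by
  have h : ∀ s, coordRows 6 ᵥ* genInt s = coordRows 6 := by decide +kernel
  rw [gen_val, intCast_vecMul, h]

lemma signedRowC_vecMul_wordProd (w : List (Fin 6)) (x : SignedIndex) :
    signedRowC x ᵥ* (wordProd w).val = signedRowC (actWord reflect w x) := by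
  induction w generalizing x with
  | nil => simp
  | cons s w ih => simp [← Matrix.vecMul_vecMul, signedRowC_vecMul_gen, ih]

lemma fixedRow_vecMul_wordProd (w : List (Fin 6)) :
    (fun k => (coordRows 6 k : ℂ)) ᵥ* (wordProd w).val = fun k => (coordRows 6 k : ℂ) := by
  induction w with
  | nil => simp
  | cons s w ih => simp only [wordProd_cons, Units.val_mul, ← Matrix.vecMul_vecMul,
      fixedRow_vecMul_gen, ih]

lemma signedRowC_injective : Function.Injective signedRowC := by
  have h : ∀ x y, signedRow x = signedRow y → x = y := by decide +kernel
  intro x y hxy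
  exact h x y (funext fun k => Int.cast_injective (congrFun hxy k))

/-- `M` acts faithfully on the signed coordinate vectors. -/
lemma wordProd_eq_iff (v w : List (Fin 6)) :
    wordProd v = wordProd w ↔ ∀ x, actWord reflect v x = actWord reflect w x := by
  constructor
  · intro h x
    apply signedRowC_injective
    rw [← signedRowC_vecMul_wordProd, ← signedRowC_vecMul_wordProd, h]
  · intro h
    set P : Matrix (Fin 7) (Fin 7) ℂ := coordRows.map (Int.castRingHom ℂ) with hP
    set Q : Matrix (Fin 7) (Fin 7) ℂ := coordRowsInv.map (Int.castRingHom ℂ) with hQ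
    have hQP : Q * P = (4 : ℂ) • (1 : Matrix (Fin 7) (Fin 7) ℂ) := by
      have h4 : coordRowsInv * coordRows = Matrix.diagonal fun _ => (4 : ℤ) := by
        decide +kernel
      rw [hP, hQ, ← Matrix.map_mul, h4]
      ext i j
      by_cases hij : i = j <;> simp [Matrix.smul_apply, hij]
    have hrow : ∀ i : Fin 7, P i ᵥ* (wordProd v).val = P i ᵥ* (wordProd w).val := by
      intro i
      induction i using Fin.lastCases with
      | last => exact (fixedRow_vecMul_wordProd v).trans (fixedRow_vecMul_wordProd w).symm
      | cast i =>
        have := (signedRowC_vecMul_wordProd v (i, false)).trans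
          ((congrArg signedRowC (h (i, false))).trans
            (signedRowC_vecMul_wordProd w (i, false)).symm)
        exact this
    have hPvw : P * (wordProd v).val = P * (wordProd w).val := by
      ext i j
      exact congrFun (hrow i) j
    have key := congrArg (fun B => Q * B) hPvw
    simp only [← Matrix.mul_assoc, hQP, Matrix.smul_mul, Matrix.one_mul] at key
    exact Units.ext (smul_right_injective _ (by norm_num : (4 : ℂ) ≠ 0) key)

/-- The subgroup generated by the simple reflections in `A`. -/
def parabolic (A : List (Fin 6)) : Subgroup (GL (Fin 7) ℂ) := Subgroup.closure (gen '' {s | s ∈ A})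

lemma gen_mem_parabolic {A : List (Fin 6)} {s : Fin 6} (hs : s ∈ A) : gen s ∈ parabolic A :=
  Subgroup.subset_closure ⟨s, hs, rfl⟩

lemma wordProd_mem_parabolic {A w : List (Fin 6)} (hw : ∀ s ∈ w, s ∈ A) :
    wordProd w ∈ parabolic A :=
  Subgroup.list_prod_mem _ fun g hg => by
    obtain ⟨s, hs, rfl⟩ := List.mem_map.mp hg
    exact gen_mem_parabolic (hw s hs)

lemma exists_word_of_mem_parabolic {A : List (Fin 6)} {g : GL (Fin 7) ℂ} (hg : g ∈ parabolic A) :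
    ∃ w : List (Fin 6), (∀ s ∈ w, s ∈ A) ∧ wordProd w = g := by
  induction hg using Subgroup.closure_induction_right with
  | one => exact ⟨[], by simp, rfl⟩
  | mul_right x _ y hy ih =>
    obtain ⟨w, hw, rfl⟩ := ih
    obtain ⟨s, hs, rfl⟩ := hy
    exact ⟨w ++ [s], by simpa [or_imp, forall_and] using ⟨hw, hs⟩, by simp⟩
  | mul_inv_cancel x _ y hy ih =>
    obtain ⟨w, hw, rfl⟩ := ih
    obtain ⟨s, hs, rfl⟩ := hy
    exact ⟨w ++ [s], by simpa [or_imp, forall_and] using ⟨hw, hs⟩, by simp [gen_inv]⟩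

lemma gA_eq : gA = gen 2 * gen 4 := by
  change gA = gA * gen 4 * gen 4
  rw [mul_assoc, gen_mul_self, mul_one]

lemma gA_mem_parabolic {A : List (Fin 6)} (h2 : 2 ∈ A) (h4 : 4 ∈ A) : gA ∈ parabolic A :=
  gA_eq ▸ mul_mem (gen_mem_parabolic h2) (gen_mem_parabolic h4)

lemma Mgp_eq_parabolic : Mgp = parabolic (List.finRange 6) := by
  apply le_antisymm
  · rw [Mgp, Subgroup.closure_le]
    rintro g (rfl | rfl | rfl | rfl | rfl | rfl)
    · exact gen_mem_parabolic (s := 5) (by decide)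
    · exact gen_mem_parabolic (s := 3) (by decide)
    · exact gen_mem_parabolic (s := 4) (by decide)
    · exact gen_mem_parabolic (s := 0) (by decide)
    · exact gen_mem_parabolic (s := 1) (by decide)
    · exact gA_mem_parabolic (by decide) (by decide)
  · rw [parabolic, Subgroup.closure_le]
    rintro g ⟨s, -, rfl⟩
    have hmem : ∀ g ∈ ({g12, g23, g34, g56, g67, gA} : Set (GL (Fin 7) ℂ)), g ∈ Mgp :=
      fun g hg => Subgroup.subset_closure hg
    fin_cases s
    · exact hmem g56 (by simp)
    · exact hmem g67 (by simp)
    · exact mul_mem (hmem gA (by simp)) (hmem g34 (by simp))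
    · exact hmem g23 (by simp)
    · exact hmem g34 (by simp)
    · exact hmem g12 (by simp)

lemma GKgp_eq_parabolic : GKgp = parabolic [0, 1, 2, 3, 4] := by
  apply le_antisymm
  · rw [GKgp, Subgroup.closure_le]
    rintro g (rfl | rfl | rfl | rfl | rfl)
    · exact gen_mem_parabolic (s := 3) (by decide)
    · exact gen_mem_parabolic (s := 4) (by decide)
    · exact gen_mem_parabolic (s := 0) (by decide)
    · exact gen_mem_parabolic (s := 1) (by decide)
    · exact gA_mem_parabolic (by decide) (by decide)
  · rw [parabolic, Subgroup.closure_le]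
    rintro g ⟨s, hs, rfl⟩
    have hmem : ∀ g ∈ ({g23, g34, g56, g67, gA} : Set (GL (Fin 7) ℂ)), g ∈ GKgp :=
      fun g hg => Subgroup.subset_closure hg
    fin_cases s
    · exact hmem g56 (by simp)
    · exact hmem g67 (by simp)
    · exact mul_mem (hmem gA (by simp)) (hmem g34 (by simp))
    · exact hmem g23 (by simp)
    · exact hmem g34 (by simp)
    · exact absurd hs (by decide)

lemma GLgp_eq_parabolic : GLgp = parabolic [1, 2, 3, 4, 5] := by
  apply le_antisymm
  · rw [GLgp, Subgroup.closure_le]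
    rintro g (rfl | rfl | rfl | rfl | rfl)
    · exact gen_mem_parabolic (s := 5) (by decide)
    · exact gen_mem_parabolic (s := 3) (by decide)
    · exact gen_mem_parabolic (s := 4) (by decide)
    · exact gen_mem_parabolic (s := 1) (by decide)
    · exact gA_mem_parabolic (by decide) (by decide)
  · rw [parabolic, Subgroup.closure_le]
    rintro g ⟨s, hs, rfl⟩
    have hmem : ∀ g ∈ ({g12, g23, g34, g67, gA} : Set (GL (Fin 7) ℂ)), g ∈ GLgp :=
      fun g hg => Subgroup.subset_closure hg
    fin_cases s
    · exact absurd hs (by decide)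
    · exact hmem g67 (by simp)
    · exact mul_mem (hmem gA (by simp)) (hmem g34 (by simp))
    · exact hmem g23 (by simp)
    · exact hmem g34 (by simp)
    · exact hmem g12 (by simp)

/-- The element of `M` spelled by a word. -/
def wordElt (w : List (Fin 6)) : Mgp :=
  ⟨wordProd w, Mgp_eq_parabolic ▸ wordProd_mem_parabolic fun s _ => List.mem_finRange s⟩

lemma wordElt_append (v w : List (Fin 6)) : wordElt (v ++ w) = wordElt v * wordElt w :=
  Subtype.ext (wordProd_append v w)

lemma wordElt_surjective : Function.Surjective wordElt := fun g => by
  obtain ⟨w, -, hw⟩ := exists_word_of_mem_parabolic (Mgp_eq_parabolic.le g.2)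
  exact ⟨w, Subtype.ext hw⟩

lemma op_smul_mk {G : Type*} [Group G] (H : Subgroup G) (g x : G) :
    MulOpposite.op g • (Quotient.mk _ x : RQ H) = Quotient.mk _ (x * g) := rfl

/-- A set `X` on which words in the generators act, together with a word `rep x` for each point `x`
leading to it from the base point, presents the right cosets of a standard parabolic subgroup. -/
structure CosetModel (A : List (Fin 6)) (X : Type*) where
  act : Fin 6 → X → X
  base : X
  rep : X → List (Fin 6)
  act_base : ∀ s ∈ A, act s base = base
  actWord_rep : ∀ x, actWord act (rep x) base = x
  rep_base : rep base = []
  rep_act : ∀ x s, ∃ w : List (Fin 6), (∀ t ∈ w, t ∈ A) ∧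
    wordProd (rep x ++ [s]) = wordProd (w ++ rep (act s x))
  actWord_congr : ∀ {v w}, wordProd v = wordProd w → ∀ x, actWord act v x = actWord act w x

namespace CosetModel

variable {A : List (Fin 6)} {X : Type*} (C : CosetModel A X) {H : Subgroup (GL (Fin 7) ℂ)}

lemma actWord_base {w : List (Fin 6)} (hw : ∀ s ∈ w, s ∈ A) : actWord C.act w C.base = C.base := by
  induction w with
  | nil => rfl
  | cons s w ih =>
    rw [actWord_cons, C.act_base s (hw s (by simp)), ih fun t ht => hw t (by simp [ht])]

lemma mk_eq_mk_iff (hH : H = parabolic A) (v w : List (Fin 6)) :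
    (Quotient.mk _ (wordElt v) : RQ (H.subgroupOf Mgp)) = Quotient.mk _ (wordElt w) ↔
      ∃ u : List (Fin 6), (∀ s ∈ u, s ∈ A) ∧ wordProd w = wordProd (u ++ v) := by
  rw [Quotient.eq, QuotientGroup.rightRel_apply, Subgroup.mem_subgroupOf, hH]
  constructor
  · intro h
    obtain ⟨u, hu, hprod⟩ := exists_word_of_mem_parabolic h
    exact ⟨u, hu, by simp [hprod, wordElt]⟩
  · rintro ⟨u, hu, h⟩
    have : ((wordElt w * (wordElt v)⁻¹ : Mgp) : GL (Fin 7) ℂ) = wordProd u := by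
      simp [wordElt, h]
    exact (congrArg (· ∈ parabolic A) this).mpr (wordProd_mem_parabolic hu)

lemma mk_wordElt (hH : H = parabolic A) (w : List (Fin 6)) :
    (Quotient.mk _ (wordElt w) : RQ (H.subgroupOf Mgp)) =
      Quotient.mk _ (wordElt (C.rep (actWord C.act w C.base))) := by
  induction w using List.reverseRecOn with
  | nil => rw [actWord_nil, C.rep_base]
  | append_singleton w s ih =>
    rw [wordElt_append, ← op_smul_mk, ih, op_smul_mk, ← wordElt_append]
    obtain ⟨u, hu, h⟩ := C.rep_act (actWord C.act w C.base) s
    exact ((mk_eq_mk_iff hH _ _).mpr ⟨u, hu, by simpa using h⟩).symm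

/-- The identification of the model with the right coset space. -/
def equiv (hH : H = parabolic A) : X ≃ RQ (H.subgroupOf Mgp) :=
  Equiv.ofBijective (fun x => Quotient.mk _ (wordElt (C.rep x))) <| by
    constructor
    · intro x y hxy
      obtain ⟨u, hu, h⟩ := (mk_eq_mk_iff hH _ _).mp hxy
      have h' := C.actWord_congr h C.base
      rwa [actWord_append, C.actWord_base hu, C.actWord_rep, C.actWord_rep, eq_comm] at h'
    · intro q
      obtain ⟨g, rfl⟩ := Quotient.exists_rep q
      obtain ⟨w, rfl⟩ := wordElt_surjective g
      exact ⟨actWord C.act w C.base, (C.mk_wordElt hH w).symm⟩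

lemma op_smul_equiv (hH : H = parabolic A) (w : List (Fin 6)) (x : X) :
    MulOpposite.op (wordElt w) • C.equiv hH x = C.equiv hH (actWord C.act w x) := by
  change MulOpposite.op (wordElt w) •
    (Quotient.mk _ (wordElt (C.rep x)) : RQ (H.subgroupOf Mgp)) = Quotient.mk _ _
  rw [op_smul_mk, ← wordElt_append, C.mk_wordElt hH, actWord_append, C.actWord_rep]

end CosetModel

/-- The word `[a - 1, …, b]`. -/
def down (a b : Fin 6) : List (Fin 6) := ((List.finRange 6).filter fun k => b ≤ k ∧ k < a).reverse

lemma reflect_injective : ∀ s, Function.Injective (reflect s) := by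
  have h : ∀ s x, reflect s (reflect s x) = x := by decide +kernel
  exact fun s => Function.LeftInverse.injective (h s)

/-- A word taking the first coordinate vector to a given signed coordinate vector. -/
def vectorWord (x : SignedIndex) : List (Fin 6) :=
  if x.2 then [0, 1, 2, 3, 5] ++ down 5 x.1 else (down x.1 0).reverse

/-- The signed coordinate vectors as a model of `G_L\M`. -/
def vectorModel : CosetModel [1, 2, 3, 4, 5] SignedIndex where
  act := reflect
  base := (0, false)
  rep := vectorWord
  act_base := by decide +kernel
  actWord_rep := by decide +kernel
  rep_base := by decide +kernel
  rep_act := by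
    have h : ∀ x s, ∃ w ∈ [[], [1], [2], [3], [4], [5]], ∀ y,
        actWord reflect (vectorWord x ++ [s]) y =
          actWord reflect (w ++ vectorWord (reflect s x)) y := by
      decide +kernel
    intro x s
    obtain ⟨w, hw, hy⟩ := h x s
    refine ⟨w, ?_, (wordProd_eq_iff _ _).mpr hy⟩
    clear hy
    revert w
    decide
  actWord_congr h := (wordProd_eq_iff _ _).mp h

/-- Introducing minus signs at a list of positions, two at a time. -/
def pairsWord : List (Fin 6) → List (Fin 6)
  | i :: j :: l => 5 :: (down 4 i ++ down 5 j) ++ pairsWord l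
  | _ => []

/-- A word taking the all-plus sign pattern to a given sign pattern. -/
def spinWord (ε : Fin 6 → Bool) : List (Fin 6) := pairsWord ((List.finRange 6).filter fun k => ε k)

/-- Whether the sign pattern `ε` has the sign of `x` in the coordinate of `x`. -/
def Agrees (ε : Fin 6 → Bool) (x : SignedIndex) : Prop := ε x.1 = x.2

instance (ε : Fin 6 → Bool) : DecidablePred (Agrees ε) := fun x => decEq (ε x.1) x.2

lemma agrees_reflect_iff (s : Fin 6) (ε : HalfSpin) (x : SignedIndex) :
    Agrees (reflectSpin s ε).1 (reflect s x) ↔ Agrees ε.1 x := by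
  have h : ∀ s (ε : Fin 6 → Bool) x, Agrees (reflectSigns s ε) (reflect s x) ↔ Agrees ε x := by
    decide +kernel
  exact h s ε.1 x

lemma agrees_actWord_iff (w : List (Fin 6)) (ε : HalfSpin) (x : SignedIndex) :
    Agrees (actWord reflectSpin w ε).1 (actWord reflect w x) ↔ Agrees ε.1 x := by
  induction w generalizing ε x with
  | nil => rfl
  | cons s w ih => rw [actWord_cons, actWord_cons, ih, agrees_reflect_iff]

/-- The half-spin weights as a model of `G_K\M`. -/
def spinModel : CosetModel [0, 1, 2, 3, 4] HalfSpin where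
  act := reflectSpin
  base := ⟨fun _ => false, by decide⟩
  rep ε := spinWord ε.1
  act_base := by decide +kernel
  actWord_rep := by decide +kernel
  rep_base := by decide +kernel
  rep_act := by
    have h : ∀ (ε : HalfSpin) s, ∃ w ∈ [[], [0], [1], [2], [3], [4]], ∀ y,
        actWord reflect (spinWord ε.1 ++ [s]) y =
          actWord reflect (w ++ spinWord (reflectSigns s ε.1)) y := by
      decide +kernel
    intro ε s
    obtain ⟨w, hw, hy⟩ := h ε s
    refine ⟨w, ?_, (wordProd_eq_iff _ _).mpr hy⟩
    clear hy
    revert w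
    decide
  actWord_congr {v w} h ε := by
    have hvw := (wordProd_eq_iff _ _).mp h
    ext k
    obtain ⟨x, hx⟩ := Finite.surjective_of_injective (actWord_injective reflect_injective v)
      (k, (actWord reflectSpin v ε).1 k)
    have hv : Agrees (actWord reflectSpin v ε).1 (actWord reflect v x) := by rw [hx]; rfl
    rw [agrees_actWord_iff, ← agrees_actWord_iff w, ← hvw, hx] at hv
    exact hv.symm

/-- A half-spin weight together with a pair of signed coordinate vectors. -/
abbrev Config := HalfSpin × {s : Finset SignedIndex // s.card = 2}

def reflectConfig (s : Fin 6) (c : Config) : Config :=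
  (reflectSpin s c.1, ⟨c.2.1.image (reflect s), by
    rw [Finset.card_image_of_injective _ (reflect_injective s), c.2.2]⟩)

lemma actWord_reflectConfig_fst (w : List (Fin 6)) (c : Config) :
    (actWord reflectConfig w c).1 = actWord reflectSpin w c.1 := by
  induction w generalizing c with
  | nil => rfl
  | cons s w ih => exact ih _

lemma actWord_reflectConfig_snd (w : List (Fin 6)) (c : Config) :
    (actWord reflectConfig w c).2.1 = c.2.1.image (actWord reflect w) := by
  induction w generalizing c with
  | nil => exact Finset.image_id.symm
  | cons s w ih =>
    rw [actWord_cons, ih]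
    exact Finset.image_image

/-- The relative position of a half-spin weight and a pair of signed coordinate vectors: `2` if the
pair is antipodal, and otherwise `0`, `1` or `3` according to whether two, one or none of the
vectors agree with the weight. -/
def relPos (c : Config) : Fin 4 :=
  if (c.2.1.image Prod.fst).card = 1 then 2
  else if (c.2.1.filter (Agrees c.1.1)).card = 2 then 0
  else if (c.2.1.filter (Agrees c.1.1)).card = 1 then 1
  else 3

lemma relPos_reflectConfig (s : Fin 6) (c : Config) : relPos (reflectConfig s c) = relPos c := by
  have hfst : ((reflectConfig s c).2.1.image Prod.fst).card = (c.2.1.image Prod.fst).card := by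
    obtain ⟨σ, hσ⟩ : ∃ σ : Equiv.Perm (Fin 6), ∀ x, (reflect s x).1 = σ x.1 :=
      ⟨if s = 5 then Equiv.swap 4 5 else Equiv.swap s (s + 1), fun x => by
        unfold reflect; split_ifs <;> rfl⟩
    rw [← Finset.card_image_of_injective (c.2.1.image Prod.fst) σ.injective, Finset.image_image]
    change ((c.2.1.image (reflect s)).image Prod.fst).card = _
    rw [Finset.image_image]
    exact congrArg (fun f => (c.2.1.image f).card) (funext hσ)
  have hagree : ((reflectConfig s c).2.1.filter (Agrees (reflectConfig s c).1.1)).card =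
      (c.2.1.filter (Agrees c.1.1)).card := by
    change ((c.2.1.image (reflect s)).filter (Agrees (reflectSpin s c.1).1)).card = _
    rw [Finset.filter_image, Finset.card_image_of_injective _ (reflect_injective s)]
    simp only [agrees_reflect_iff]
  unfold relPos
  rw [hfst, hagree]

lemma relPos_actWord (w : List (Fin 6)) (c : Config) :
    relPos (actWord reflectConfig w c) = relPos c := by
  induction w generalizing c with
  | nil => rfl
  | cons s w ih => rw [actWord_cons, ih, relPos_reflectConfig]

/-- A standard pair in each position relative to the all-plus weight. -/
def stdPair : Fin 4 → {s : Finset SignedIndex // s.card = 2} :=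
  ![⟨{(0, false), (1, false)}, by decide⟩, ⟨{(0, false), (1, true)}, by decide⟩,
    ⟨{(0, false), (0, true)}, by decide⟩, ⟨{(0, true), (1, true)}, by decide⟩]

def stdConfig (i : Fin 4) : Config := (spinModel.base, stdPair i)

lemma relPos_stdConfig : ∀ i, relPos (stdConfig i) = i := by
  decide +kernel

/-- The words in `0, …, 4` move every pair to a standard pair. -/
lemma exists_word_to_stdPair (s : {s : Finset SignedIndex // s.card = 2}) :
    ∃ w : List (Fin 6), (∀ t ∈ w, t ∈ [0, 1, 2, 3, 4]) ∧
      ∃ k, s.1.image (actWord reflect w) = (stdPair k).1 := by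
  have h : ∀ x y : SignedIndex, x ≠ y → ∃ l ∈ [[], [(0 : Fin 6)]],
      let w := down x.1 0 ++ down (if y.1 < x.1 then y.1 + 1 else y.1) 1 ++ l
      (∀ t ∈ w, t ∈ [0, 1, 2, 3, 4]) ∧
        ∃ k, {actWord reflect w x, actWord reflect w y} = (stdPair k).1 := by
    decide +kernel
  obtain ⟨x, y, hxy, hs⟩ := Finset.card_eq_two.mp s.2
  obtain ⟨l, -, hw, k, hk⟩ := h x y hxy
  exact ⟨_, hw, k, by rw [hs, Finset.image_insert, Finset.image_singleton, hk]⟩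

lemma exists_word_to_stdConfig (c : Config) :
    ∃ w : List (Fin 6), actWord reflectConfig w c = stdConfig (relPos c) := by
  suffices ∃ w k, actWord reflectConfig w c = stdConfig k by
    obtain ⟨w, k, h⟩ := this
    have hk := relPos_actWord w c
    rw [h, relPos_stdConfig] at hk
    exact ⟨w, hk ▸ h⟩
  have hbase : ∀ ε : HalfSpin, actWord reflectSpin (spinWord ε.1).reverse ε = spinModel.base := by
    decide +kernel
  set v := (spinWord c.1.1).reverse
  obtain ⟨w, hw, k, hk⟩ := exists_word_to_stdPair (actWord reflectConfig v c).2
  refine ⟨v ++ w, k, Prod.ext ?_ (Subtype.ext ?_)⟩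
  · rw [actWord_reflectConfig_fst, actWord_append, hbase]
    exact spinModel.actWord_base hw
  · rw [actWord_append, actWord_reflectConfig_snd, hk]
    rfl

/-- A bijection onto a second type turns finsets into sets of the same cardinality. -/
def finsetCardEquiv {X Y : Type*} [Finite X] (e : X ≃ Y) (k : ℕ) :
    {s : Finset X // s.card = k} ≃ {s : Set Y // s.ncard = k} :=
  Equiv.ofBijective
    (fun s => ⟨e '' s.1, by
      rw [Set.ncard_image_of_injective _ e.injective, Set.ncard_coe_finset, s.2]⟩) <| by
    constructor
    · intro s t hst
      exact Subtype.ext (Finset.coe_injective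
        (e.injective.image_injective (congrArg Subtype.val hst)))
    · rintro ⟨t, ht⟩
      have hfin : (e ⁻¹' t).Finite := Set.toFinite _
      refine ⟨⟨hfin.toFinset, ?_⟩, Subtype.ext ?_⟩
      · rw [← Set.ncard_eq_toFinset_card _ hfin, ← ht,
          ← Set.ncard_image_of_injective _ e.injective, e.image_preimage]
      · simp [e.image_preimage]

/-- Configurations as a model of `(G_K\M) × S(L²)`. -/
def configEquiv : Config ≃ RCK × {s : Set RCL // s.ncard = 2} :=
  (spinModel.equiv GKgp_eq_parabolic).prodCongr
    (finsetCardEquiv (vectorModel.equiv GLgp_eq_parabolic) 2)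

lemma op_smul_configEquiv (w : List (Fin 6)) (c : Config) :
    MulOpposite.op (wordElt w) • configEquiv c = configEquiv (actWord reflectConfig w c) := by
  refine Prod.ext ?_ (Subtype.ext ?_)
  · refine (spinModel.op_smul_equiv GKgp_eq_parabolic w c.1).trans ?_
    exact congrArg _ (actWord_reflectConfig_fst w c).symm
  · change (fun q => MulOpposite.op (wordElt w) • q) ''
        (vectorModel.equiv GLgp_eq_parabolic '' (c.2.1 : Set SignedIndex)) =
      vectorModel.equiv GLgp_eq_parabolic '' ((actWord reflectConfig w c).2.1 : Set SignedIndex)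
    rw [actWord_reflectConfig_snd, Finset.coe_image, Set.image_image, Set.image_image]
    exact Set.image_congr fun x _ => vectorModel.op_smul_equiv GLgp_eq_parabolic w x

lemma mem_orbit_stdConfig_iff (i : Fin 4) (c : Config) :
    configEquiv c ∈ MulAction.orbit (↥Mgp)ᵐᵒᵖ (configEquiv (stdConfig i)) ↔ relPos c = i := by
  constructor
  · rintro ⟨g, hg⟩
    obtain ⟨w, hw⟩ := wordElt_surjective g.unop
    have h : configEquiv (actWord reflectConfig w (stdConfig i)) = configEquiv c := by
      rw [← op_smul_configEquiv, hw]
      exact hg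
    rw [← configEquiv.injective h, relPos_actWord, relPos_stdConfig]
  · rintro rfl
    obtain ⟨w, hw⟩ := exists_word_to_stdConfig c
    rw [MulAction.mem_orbit_symm, ← hw, ← op_smul_configEquiv]
    exact MulAction.mem_orbit _ _

lemma card_orbit_stdConfig (i : Fin 4) :
    Nat.card (MulAction.orbit (↥Mgp)ᵐᵒᵖ (configEquiv (stdConfig i))) =
      Nat.card {c : Config // relPos c = i} :=
  (Nat.card_congr (configEquiv.subtypeEquiv fun c => (mem_orbit_stdConfig_iff i c).symm)).symm

lemma card_relPos_fiber (i : Fin 4) :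
    Nat.card {c : Config // relPos c = i} = ![480, 960, 192, 480] i := by
  have h : ∀ i, (Finset.univ.filter fun c : Config => relPos c = i).card =
      ![480, 960, 192, 480] i := by
    decide +kernel
  rw [← h]
  exact Nat.subtype_card _ fun c => Finset.mem_filter_univ c

/-- The action of `M` (acting on the right) on
`(G_K\\M) × S(L²)` has exactly four orbits, of sizes 480, 960, 192 and 480. -/
theorem four_orbits_on_SKL2 :
    ∃ p : Fin 4 → RCK × {s : Set RCL // s.ncard = 2},
      (∀ i j : Fin 4, i ≠ j →
        MulAction.orbit (↥Mgp)ᵐᵒᵖ (p i) ≠ MulAction.orbit (↥Mgp)ᵐᵒᵖ (p j)) ∧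
      (∀ q : RCK × {s : Set RCL // s.ncard = 2},
        ∃ i : Fin 4, q ∈ MulAction.orbit (↥Mgp)ᵐᵒᵖ (p i)) ∧
      Nat.card (MulAction.orbit (↥Mgp)ᵐᵒᵖ (p 0)) = 480 ∧
      Nat.card (MulAction.orbit (↥Mgp)ᵐᵒᵖ (p 1)) = 960 ∧
      Nat.card (MulAction.orbit (↥Mgp)ᵐᵒᵖ (p 2)) = 192 ∧
      Nat.card (MulAction.orbit (↥Mgp)ᵐᵒᵖ (p 3)) = 480 := by
  have hcard (i : Fin 4) := (card_orbit_stdConfig i).trans (card_relPos_fiber i)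
  refine ⟨fun i => configEquiv (stdConfig i), fun i j hij h => hij ?_, fun q => ?_,
    hcard 0, hcard 1, hcard 2, hcard 3⟩
  · have hi := MulAction.mem_orbit_self (M := (↥Mgp)ᵐᵒᵖ) (configEquiv (stdConfig i))
    rwa [h, mem_orbit_stdConfig_iff, relPos_stdConfig] at hi
  · obtain ⟨c, rfl⟩ := configEquiv.surjective q
    exact ⟨relPos c, (mem_orbit_stdConfig_iff _ c).mpr rfl⟩

end KLPaper
end
end

section
/- Let T be the disjoint union (G_K\M) ⊔ (G_L\M), with M acting by right multiplication on each part, and let T⁽³⁾ be the set of three-element subsets of T, with M acting elementwise. Then this action of M on T⁽³⁾ has exactly eighteen orbits. More precisely: there are exactly 2 orbits whose members consist of three elements of G_L\M; exactly 4 orbits whose members contain one element of G_K\M and two elements of G_L\M; exactly 7 orbits whose members contain one element of G_L\M and two elements of G_K\M; and exactly 5 orbits whose members consist of three elements of G_K\M. -/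
open Matrix MulAction Pointwise

noncomputable section

namespace KLPaper

/-- `T = (G_K\\M) ⊔ (G_L\\M)`. -/
abbrev Tspace := RCK ⊕ RCL

/-- `T⁽³⁾`, the set of three-element subsets of `T`. -/
abbrev T3 := {s : Set Tspace // s.ncard = 3}

/-- The number of elements of a three-element subset of `T` coming from `G_K\\M`. -/
def kcount (s : T3) : ℕ := (s.1 ∩ Set.range Sum.inl).ncard

/-! ### The Coxeter generators

`M` is a Weyl group of type `D₆`. The matrix `A` is not a reflection, but `(34)A` is, and together
with the five transpositions it forms a simple system in which `(34)` and `(12)` are the two ends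
of the fork. -/

/-- The simple reflections of `M`, as integral matrices. -/
def reflMat : Fin 6 → Matrix (Fin 7) (Fin 7) ℤ := ![t56, t67, t34 * tA, t23, t34, t12]

/-- The simple reflections of `M`, as elements of `GL (Fin 7) ℂ`. -/
def reflGL : Fin 6 → GL (Fin 7) ℂ := ![g56, g67, g34 * gA, g23, g34, g12]

lemma coe_reflGL (s : Fin 6) :
    (reflGL s : Matrix (Fin 7) (Fin 7) ℂ) = (reflMat s).map (Int.castRingHom ℂ) := by
  fin_cases s <;> first | rfl | exact (Matrix.map_mul (f := Int.castRingHom ℂ)).symm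

lemma toGL_mul_self (A : Matrix (Fin 7) (Fin 7) ℤ) (h : A * A = 1) : toGL A h * toGL A h = 1 :=
  Units.ext (toGL A h).val_inv

lemma g34_mul_self : g34 * g34 = 1 := toGL_mul_self _ _

lemma reflMat_mul_self (s : Fin 6) : reflMat s * reflMat s = 1 := by
  revert s; decide +kernel

lemma reflGL_mul_self (s : Fin 6) : reflGL s * reflGL s = 1 := by
  ext1
  rw [Units.val_mul, coe_reflGL, ← Matrix.map_mul, reflMat_mul_self]
  exact Matrix.map_one _ (by simp) (by simp)

lemma reflGL_mem_Mgp (s : Fin 6) : reflGL s ∈ Mgp := by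
  have h : ∀ g ∈ ({g12, g23, g34, g56, g67, gA} : Set (GL (Fin 7) ℂ)), g ∈ Mgp :=
    fun g hg => Subgroup.subset_closure hg
  fin_cases s
  · exact h g56 (by simp)
  · exact h g67 (by simp)
  · exact mul_mem (h g34 (by simp)) (h gA (by simp))
  · exact h g23 (by simp)
  · exact h g34 (by simp)
  · exact h g12 (by simp)

lemma reflGL_mem_GKgp (s : Fin 6) (hs : s ≠ 5) : reflGL s ∈ GKgp := by
  have h : ∀ g ∈ ({g23, g34, g56, g67, gA} : Set (GL (Fin 7) ℂ)), g ∈ GKgp :=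
    fun g hg => Subgroup.subset_closure hg
  fin_cases s
  · exact h g56 (by simp)
  · exact h g67 (by simp)
  · exact mul_mem (h g34 (by simp)) (h gA (by simp))
  · exact h g23 (by simp)
  · exact h g34 (by simp)
  · exact absurd rfl hs

lemma reflGL_mem_GLgp (s : Fin 6) (hs : s ≠ 0) : reflGL s ∈ GLgp := by
  have h : ∀ g ∈ ({g12, g23, g34, g67, gA} : Set (GL (Fin 7) ℂ)), g ∈ GLgp :=
    fun g hg => Subgroup.subset_closure hg
  fin_cases s
  · exact absurd rfl hs
  · exact h g67 (by simp)
  · exact mul_mem (h g34 (by simp)) (h gA (by simp))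
  · exact h g23 (by simp)
  · exact h g34 (by simp)
  · exact h g12 (by simp)

/-- The simple reflections of `M`. -/
def simpleRefl (s : Fin 6) : Mgp := ⟨reflGL s, reflGL_mem_Mgp s⟩

/-- The element of `M` spelled by a word in the simple reflections. -/
def eval (w : List (Fin 6)) : Mgp := (w.map simpleRefl).prod

lemma eval_append (v w : List (Fin 6)) : eval (v ++ w) = eval v * eval w := by
  simp [eval]

lemma eval_cons (s : Fin 6) (w : List (Fin 6)) : eval (s :: w) = simpleRefl s * eval w := by
  simp [eval]

lemma eval_singleton (s : Fin 6) : eval [s] = simpleRefl s := by simp [eval]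

lemma eval_mul_eval_reverse (w : List (Fin 6)) : eval w * eval w.reverse = 1 := by
  induction w with
  | nil => exact one_mul 1
  | cons s w ih =>
    rw [List.reverse_cons, eval_append, eval_cons, eval_singleton, mul_assoc, ← mul_assoc (eval w),
      ih, one_mul]
    exact Subtype.ext (reflGL_mul_self s)

lemma exists_eval_eq {g : GL (Fin 7) ℂ} (hg : g ∈ Mgp) : ∃ w, (eval w : GL (Fin 7) ℂ) = g := by
  induction hg using Subgroup.closure_induction with
  | mem x hx =>
    have h : ∀ s, (eval [s] : GL (Fin 7) ℂ) = reflGL s := fun s => by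
      rw [eval_singleton]; rfl
    rcases hx with rfl | rfl | rfl | rfl | rfl | rfl
    · exact ⟨[5], h 5⟩
    · exact ⟨[3], h 3⟩
    · exact ⟨[4], h 4⟩
    · exact ⟨[0], h 0⟩
    · exact ⟨[1], h 1⟩
    · refine ⟨[4] ++ [2], ?_⟩
      rw [eval_append, Subgroup.coe_mul, h, h]
      change g34 * (g34 * gA) = gA
      rw [← mul_assoc, g34_mul_self, one_mul]
  | one => exact ⟨[], rfl⟩
  | mul x y _ _ hx hy =>
    obtain ⟨v, rfl⟩ := hx
    obtain ⟨w, rfl⟩ := hy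
    exact ⟨v ++ w, by rw [eval_append]; rfl⟩
  | inv x _ hx =>
    obtain ⟨w, rfl⟩ := hx
    refine ⟨w.reverse, ?_⟩
    rw [← Subgroup.coe_inv, eq_inv_of_mul_eq_one_right (eval_mul_eval_reverse w)]

lemma eval_surjective : Function.Surjective eval := fun g =>
  (exists_eval_eq g.2).imp fun _ hw => Subtype.ext hw

/-! ### The standard coordinates of type `D₆` -/

/-- Integral vectors with six coordinates. -/
abbrev Vec := ℤ × ℤ × ℤ × ℤ × ℤ × ℤ

/-- The simple reflections of type `D₆`, in standard coordinates. -/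
def refl : Fin 6 → Vec → Vec
  | 0, (a, b, c, d, e, f) => (b, a, c, d, e, f)
  | 1, (a, b, c, d, e, f) => (a, c, b, d, e, f)
  | 2, (a, b, c, d, e, f) => (a, b, d, c, e, f)
  | 3, (a, b, c, d, e, f) => (a, b, c, e, d, f)
  | 4, (a, b, c, d, e, f) => (a, b, c, d, f, e)
  | 5, (a, b, c, d, e, f) => (a, b, c, d, -f, -e)

/-- The right action of words in the simple reflections. -/
def run (w : List (Fin 6)) (x : Vec) : Vec := w.foldl (fun y s => refl s y) x

@[simp] lemma run_nil (x : Vec) : run [] x = x := rfl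

@[simp] lemma run_cons (s : Fin 6) (w : List (Fin 6)) (x : Vec) :
    run (s :: w) x = run w (refl s x) := rfl

/-- The standard inner product. -/
def dot : Vec → Vec → ℤ
  | (a, b, c, d, e, f), (a₂, b₂, c₂, d₂, e₂, f₂) =>
    a * a₂ + b * b₂ + c * c₂ + d * d₂ + e * e₂ + f * f₂

lemma dot_comm (x y : Vec) : dot x y = dot y x := by
  simp only [dot]; ring

lemma dot_refl (s : Fin 6) (x y : Vec) : dot (refl s x) (refl s y) = dot x y := by
  fin_cases s <;> simp only [dot, refl] <;> ring

lemma dot_run (w : List (Fin 6)) (x y : Vec) : dot (run w x) (run w y) = dot x y := by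
  induction w generalizing x y with
  | nil => rfl
  | cons s w ih => rw [run_cons, run_cons, ih, dot_refl]

lemma refl_injective (s : Fin 6) : Function.Injective (refl s) := by
  have h : Function.Involutive (refl s) := by
    rintro ⟨a, b, c, d, e, f⟩
    fin_cases s <;> simp [refl]
  exact h.injective

lemma run_injective (w : List (Fin 6)) : Function.Injective (run w) := by
  induction w with
  | nil => exact Function.injective_id
  | cons s w ih => exact ih.comp (refl_injective s)

/-- The row vector of `ℤ⁷` with given `D₆`-coordinates and given component `k` along the
vector `(1,1,1,1,-1,-1,-1)` fixed by `M`. -/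
def row (k : ℤ) : Vec → Fin 7 → ℤ
  | (a, b, c, d, e, f) =>
    ![-a - b - c - d - e - f + k, -a - b - c - d + e + f + k, -a - b - c + d - e + f + k,
      -a - b - c + d + e - f + k, 2 * a - k, 2 * b - k, 2 * c - k]

lemma row_vecMul_reflMat (k : ℤ) (x : Vec) (s : Fin 6) :
    row k x ᵥ* reflMat s = row k (refl s x) := by
  obtain ⟨a, b, c, d, e, f⟩ := x
  ext i
  fin_cases s <;> fin_cases i <;>
    simp [reflMat, tA, t12, t23, t34, t56, t67, row, refl, Matrix.vecMul, dotProduct,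
      Fin.sum_univ_succ] <;> ring

/-- The matrix spelled by a word in the simple reflections. -/
def evalMat (w : List (Fin 6)) : Matrix (Fin 7) (Fin 7) ℤ := (w.map reflMat).prod

lemma coe_eval (w : List (Fin 6)) :
    ((eval w : GL (Fin 7) ℂ) : Matrix (Fin 7) (Fin 7) ℂ) =
      (evalMat w).map (Int.castRingHom ℂ) := by
  induction w with
  | nil => exact (Matrix.map_one _ (by simp) (by simp)).symm
  | cons s w ih =>
    have h : evalMat (s :: w) = reflMat s * evalMat w := by simp [evalMat]
    rw [h, Matrix.map_mul, ← ih, ← coe_reflGL, eval_cons]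
    rfl

lemma row_vecMul_evalMat (k : ℤ) (w : List (Fin 6)) (x : Vec) :
    row k x ᵥ* evalMat w = row k (run w x) := by
  induction w generalizing x with
  | nil => simp [evalMat]
  | cons s w ih =>
    have h : evalMat (s :: w) = reflMat s * evalMat w := by simp [evalMat]
    rw [h, ← Matrix.vecMul_vecMul, row_vecMul_reflMat, ih, run_cons]

/-- The `D₆`-coordinates of four times the standard basis vectors of `ℤ⁷`. -/
def basisVec : Fin 7 → Vec :=
  ![(-1, -1, -1, -1, -1, -1), (-1, -1, -1, -1, 1, 1), (-1, -1, -1, 1, -1, 1),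
    (-1, -1, -1, 1, 1, -1), (0, -2, -2, 0, 0, 0), (-2, 0, -2, 0, 0, 0), (-2, -2, 0, 0, 0, 0)]

lemma row_basisVec (i : Fin 7) :
    row (if i < 4 then -2 else -4) (basisVec i) = (4 : ℤ) • Pi.single i 1 := by
  revert i; decide +kernel

lemma eval_eq_eval {v w : List (Fin 6)} (h : ∀ i, run v (basisVec i) = run w (basisVec i)) :
    eval v = eval w := by
  have key : evalMat v = evalMat w := by
    ext i j
    have h₁ := row_vecMul_evalMat (if i < 4 then -2 else -4) v (basisVec i)
    rw [h i, ← row_vecMul_evalMat, row_basisVec, Matrix.smul_vecMul, Matrix.smul_vecMul,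
      Matrix.single_one_vecMul, Matrix.single_one_vecMul] at h₁
    have h₂ := congrFun h₁ j
    simpa using h₂
  ext1; ext1
  rw [coe_eval, coe_eval, key]

/-! ### Parametrizing `T` by weights -/

/-- The 32 weights of a half-spin representation, which label `G_K\M`. -/
def spinWeights : List Vec := do
  let a ← [1, -1]; let b ← [1, -1]; let c ← [1, -1]
  let d ← [1, -1]; let e ← [1, -1]; let f ← [1, -1]
  if a * b * c * d * e * f = 1 then [(a, b, c, d, e, f)] else []

/-- Three times the 12 weights of the vector representation, which label `G_L\M`. -/
def vectorWeights : List Vec := do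
  let t ← [3, -3]
  [(t, 0, 0, 0, 0, 0), (0, t, 0, 0, 0, 0), (0, 0, t, 0, 0, 0), (0, 0, 0, t, 0, 0),
    (0, 0, 0, 0, t, 0), (0, 0, 0, 0, 0, t)]

/-- The labels of the elements of `T`. -/
def weights : List Vec := spinWeights ++ vectorWeights

/-- The label of the base point of `G_K\M`. -/
def spinTop : Vec := (1, 1, 1, 1, 1, 1)

/-- The label of the base point of `G_L\M`. -/
def vectorTop : Vec := (3, 0, 0, 0, 0, 0)

/-- The pairing of a weight with the half-sum of the positive roots. -/
def height (x : Vec) : ℤ := dot x (5, 4, 3, 2, 1, 0)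

/-- A word carrying the highest weight to `x`, found by greedy ascent. -/
def pathTo : ℕ → Vec → List (Fin 6)
  | 0, _ => []
  | n + 1, x =>
    match (List.finRange 6).find? fun s => height x < height (refl s x) with
    | none => []
    | some s => pathTo n (refl s x) ++ [s]

lemma refl_mem_weights {x : Vec} (hx : x ∈ weights) (s : Fin 6) : refl s x ∈ weights := by
  revert x s; decide +kernel

lemma run_mem_weights {x : Vec} (hx : x ∈ weights) (w : List (Fin 6)) : run w x ∈ weights := by
  induction w generalizing x with
  | nil => exact hx
  | cons s w ih => exact ih (refl_mem_weights hx s)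

lemma run_pathTo {x : Vec} (hx : x ∈ weights) :
    run (pathTo 15 x) (if dot x x = 6 then spinTop else vectorTop) = x := by
  revert x; decide +kernel

lemma exists_pathTo_append {x : Vec} (hx : x ∈ weights) (s : Fin 6) :
    ∃ v ∈ [] :: (List.finRange 6).map (fun t => [t]),
      (if dot x x = 6 then 5 else 0) ∉ v ∧
      ∀ i, run (pathTo 15 x ++ [s]) (basisVec i) =
        run (v ++ pathTo 15 (refl s x)) (basisVec i) := by
  revert x s; decide +kernel

/-- The element of `T` labelled by a weight. -/
def point (x : Vec) : Tspace :=
  if dot x x = 6 then Sum.inl (Quotient.mk _ (eval (pathTo 15 x)))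
  else Sum.inr (Quotient.mk _ (eval (pathTo 15 x)))

lemma mk_mul_eq {G : Type*} [Group G] (H : Subgroup G) {h : G} (hh : h ∈ H) (x : G) :
    (Quotient.mk _ (h * x) : RQ H) = Quotient.mk _ x :=
  Quotient.sound (QuotientGroup.rightRel_apply.mpr (by simpa [_root_.mul_inv_rev] using hh))

lemma eval_mem_of_notMem {H : Subgroup (GL (Fin 7) ℂ)} {s : Fin 6}
    (hH : ∀ t, t ≠ s → reflGL t ∈ H) {v : List (Fin 6)} (hs : s ∉ v) :
    eval v ∈ H.subgroupOf Mgp := by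
  induction v with
  | nil => exact one_mem _
  | cons t v ih =>
    rw [List.mem_cons, not_or] at hs
    rw [eval_cons]
    exact mul_mem (Subgroup.mem_subgroupOf.mpr (hH t (Ne.symm hs.1))) (ih hs.2)

lemma op_simpleRefl_smul_point {x : Vec} (hx : x ∈ weights) (s : Fin 6) :
    MulOpposite.op (simpleRefl s) • point x = point (refl s x) := by
  obtain ⟨v, -, hv, hrun⟩ := exists_pathTo_append hx s
  have h := eval_eq_eval hrun
  rw [eval_append, eval_append, eval_singleton] at h
  unfold point
  rw [dot_refl]
  split_ifs at hv ⊢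
  · rw [Sum.smul_inl, op_smul_mk, h,
      mk_mul_eq _ (eval_mem_of_notMem reflGL_mem_GKgp hv)]
  · rw [Sum.smul_inr, op_smul_mk, h,
      mk_mul_eq _ (eval_mem_of_notMem reflGL_mem_GLgp hv)]

lemma op_eval_smul_point {x : Vec} (hx : x ∈ weights) (w : List (Fin 6)) :
    MulOpposite.op (eval w) • point x = point (run w x) := by
  induction w generalizing x with
  | nil => exact one_smul _ _
  | cons s w ih =>
    rw [eval_cons, MulOpposite.op_mul, mul_smul, op_simpleRefl_smul_point hx,
      ih (refl_mem_weights hx s), run_cons]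

lemma exists_point_eq (t : Tspace) : ∃ x ∈ weights, point x = t := by
  rcases t with q | q <;> induction q using Quotient.inductionOn with | h g => ?_
  all_goals obtain ⟨w, rfl⟩ := eval_surjective g
  · have h : spinTop ∈ weights := by decide +kernel
    refine ⟨_, run_mem_weights h w, ?_⟩
    rw [← op_eval_smul_point h, show point spinTop = Sum.inl (Quotient.mk _ 1) from rfl,
      Sum.smul_inl, op_smul_mk, one_mul]
  · have h : vectorTop ∈ weights := by decide +kernel
    refine ⟨_, run_mem_weights h w, ?_⟩
    rw [← op_eval_smul_point h, show point vectorTop = Sum.inr (Quotient.mk _ 1) from rfl,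
      Sum.smul_inr, op_smul_mk, one_mul]

/-- The stabilizer of a row vector under right multiplication. -/
def rowStabilizer (v : Fin 7 → ℂ) : Subgroup (GL (Fin 7) ℂ) where
  carrier := {g | v ᵥ* (g : Matrix (Fin 7) (Fin 7) ℂ) = v}
  one_mem' := by simp
  mul_mem' {g h} hg hh := by
    simp only [Set.mem_ofPred_eq] at *
    rw [Units.val_mul, ← Matrix.vecMul_vecMul, hg, hh]
  inv_mem' {g} hg := by
    simp only [Set.mem_ofPred_eq] at *
    conv_lhs => rw [← hg]
    rw [Matrix.vecMul_vecMul, ← Units.val_mul, mul_inv_cancel, Units.val_one, Matrix.vecMul_one]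

lemma vecMul_map_intCast (v : Fin 7 → ℤ) (A : Matrix (Fin 7) (Fin 7) ℤ) :
    Int.castRingHom ℂ ∘ (v ᵥ* A) = (Int.castRingHom ℂ ∘ v) ᵥ* A.map (Int.castRingHom ℂ) :=
  funext fun i => RingHom.map_vecMul (Int.castRingHom ℂ) A v i

lemma toGL_mem_rowStabilizer {v : Fin 7 → ℤ} {A : Matrix (Fin 7) (Fin 7) ℤ} (h : A * A = 1)
    (hv : v ᵥ* A = v) : toGL A h ∈ rowStabilizer (Int.castRingHom ℂ ∘ v) := by
  change (Int.castRingHom ℂ ∘ v) ᵥ* A.map (Int.castRingHom ℂ) = _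
  rw [← vecMul_map_intCast, hv]

lemma GKgp_le_rowStabilizer : GKgp ≤ rowStabilizer (Int.castRingHom ℂ ∘ row 0 spinTop) := by
  rw [GKgp, Subgroup.closure_le]
  rintro _ (rfl | rfl | rfl | rfl | rfl) <;>
    exact toGL_mem_rowStabilizer _ (by decide +kernel)

lemma GLgp_le_rowStabilizer : GLgp ≤ rowStabilizer (Int.castRingHom ℂ ∘ row 0 vectorTop) := by
  rw [GLgp, Subgroup.closure_le]
  rintro _ (rfl | rfl | rfl | rfl | rfl) <;>
    exact toGL_mem_rowStabilizer _ (by decide +kernel)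

lemma row_zero_injective : Function.Injective (row 0) := by
  rintro ⟨a, b, c, d, e, f⟩ ⟨a₂, b₂, c₂, d₂, e₂, f₂⟩ h
  have h0 := congrFun h 0
  have h1 := congrFun h 1
  have h2 := congrFun h 2
  have h4 := congrFun h 4
  have h5 := congrFun h 5
  have h6 := congrFun h 6
  simp [row] at h0 h1 h2 h4 h5 h6
  simp only [Prod.mk.injEq]
  omega

lemma run_eq_of_mk_eq {H : Subgroup (GL (Fin 7) ℂ)} {x : Vec}
    (hH : H ≤ rowStabilizer (Int.castRingHom ℂ ∘ row 0 x)) {v w : List (Fin 6)}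
    (h : (Quotient.mk _ (eval v) : RQ (H.subgroupOf Mgp)) = Quotient.mk _ (eval w)) :
    run v x = run w x := by
  have hmem := hH (Subgroup.mem_subgroupOf.mp
    (QuotientGroup.rightRel_apply.mp (Quotient.exact h)))
  set c := Int.castRingHom ℂ ∘ row 0 x with hc
  have hrun : ∀ u, c ᵥ* ((eval u : GL (Fin 7) ℂ) : Matrix (Fin 7) (Fin 7) ℂ) =
      Int.castRingHom ℂ ∘ row 0 (run u x) := fun u => by
    rw [coe_eval, hc, ← vecMul_map_intCast, row_vecMul_evalMat]
  have hvw : c ᵥ* ((eval w : GL (Fin 7) ℂ) : Matrix (Fin 7) (Fin 7) ℂ) =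
      c ᵥ* ((eval v : GL (Fin 7) ℂ) : Matrix (Fin 7) (Fin 7) ℂ) := by
    have h' : c ᵥ* ((eval w * (eval v)⁻¹ : Mgp) : GL (Fin 7) ℂ).val = c := hmem
    conv_rhs => rw [← h']
    rw [Matrix.vecMul_vecMul, ← Units.val_mul, ← Subgroup.coe_mul, inv_mul_cancel_right]
  rw [hrun, hrun] at hvw
  refine row_zero_injective (funext fun i => ?_)
  simpa using (congrFun hvw i).symm

lemma point_injOn : Set.InjOn point {x | x ∈ weights} := by
  intro x hx y hy h
  have hx' := run_pathTo hx
  have hy' := run_pathTo hy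
  unfold point at h
  split_ifs at h hx' hy'
  · rw [← hx', ← hy']
    exact run_eq_of_mk_eq GKgp_le_rowStabilizer (Sum.inl.inj h)
  · rw [← hx', ← hy']
    exact run_eq_of_mk_eq GLgp_le_rowStabilizer (Sum.inr.inj h)

/-! ### Classification of triples of weights -/

/-- Representatives of the orbits of triples of weights. -/
def reps : Fin 18 → Vec × Vec × Vec :=
  ![((3, 0, 0, 0, 0, 0), (-3, 0, 0, 0, 0, 0), (0, 3, 0, 0, 0, 0)),
    ((3, 0, 0, 0, 0, 0), (0, 3, 0, 0, 0, 0), (0, 0, 3, 0, 0, 0)),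
    ((1, 1, 1, 1, 1, 1), (0, 0, 0, 0, 0, -3), (0, 0, 0, 0, -3, 0)),
    ((3, 0, 0, 0, 0, 0), (-1, 1, 1, 1, 1, -1), (0, 3, 0, 0, 0, 0)),
    ((3, 0, 0, 0, 0, 0), (-3, 0, 0, 0, 0, 0), (-1, 1, 1, 1, 1, -1)),
    ((3, 0, 0, 0, 0, 0), (0, 3, 0, 0, 0, 0), (1, 1, 1, 1, 1, 1)),
    ((1, 1, 1, 1, 1, 1), (1, 1, 1, 1, -1, -1), (3, 0, 0, 0, 0, 0)),
    ((1, 1, 1, 1, 1, 1), (1, 1, -1, -1, -1, -1), (3, 0, 0, 0, 0, 0)),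
    ((1, 1, 1, 1, 1, 1), (-1, -1, -1, -1, -1, -1), (0, 0, 0, 0, 0, -3)),
    ((1, 1, 1, 1, 1, 1), (0, 0, 0, 0, 0, -3), (1, 1, 1, 1, -1, -1)),
    ((1, 1, 1, 1, 1, 1), (0, 0, 0, 0, 0, -3), (1, 1, -1, -1, -1, -1)),
    ((3, 0, 0, 0, 0, 0), (-1, 1, 1, 1, 1, -1), (-1, 1, 1, 1, -1, 1)),
    ((3, 0, 0, 0, 0, 0), (-1, 1, 1, 1, 1, -1), (-1, 1, -1, -1, -1, 1)),
    ((1, 1, 1, 1, 1, 1), (1, 1, 1, 1, -1, -1), (1, 1, 1, -1, 1, -1)),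
    ((1, 1, 1, 1, 1, 1), (1, 1, -1, -1, -1, -1), (1, 1, 1, 1, -1, -1)),
    ((1, 1, 1, 1, 1, 1), (1, 1, -1, -1, -1, -1), (1, -1, 1, -1, -1, -1)),
    ((1, 1, 1, 1, 1, 1), (1, 1, -1, -1, -1, -1), (-1, -1, 1, 1, -1, -1)),
    ((1, 1, 1, 1, 1, 1), (-1, -1, -1, -1, -1, -1), (1, 1, -1, -1, -1, -1))]

/-- The underlying set of a triple. -/
def tripleSet (p : Vec × Vec × Vec) : Finset Vec := {p.1, p.2.1, p.2.2}

set_option synthInstance.maxHeartbeats 200000 in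
set_option synthInstance.maxSize 1000 in
lemma ascend_or_mem_reps : ∀ x ∈ weights,
    (∃ s, height x < height (refl s x)) ∨ ∀ y ∈ weights,
    (∃ s, refl s x = x ∧ height y < height (refl s y)) ∨ ∀ z ∈ weights,
    (∃ s, refl s x = x ∧ refl s y = y ∧ height z < height (refl s z)) ∨
    x = y ∨ x = z ∨ y = z ∨ ¬ dot x y ≤ dot x z ∨ ¬ dot x z ≤ dot y z ∨
    ∃ i, (x, y, z) = reps i := by
  decide +kernel

lemma height_le {x : Vec} (hx : x ∈ weights) : height x ≤ 15 := by
  revert x; decide +kernel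

/-- Any three weights with sorted inner products can be moved onto a representative, by
repeatedly raising the first weight that is not yet as high as possible. -/
theorem exists_run_eq_reps (x y z : Vec) (hx : x ∈ weights) (hy : y ∈ weights)
    (hz : z ∈ weights) (hxy : x ≠ y) (hxz : x ≠ z) (hyz : y ≠ z) (h₁ : dot x y ≤ dot x z)
    (h₂ : dot x z ≤ dot y z) : ∃ w i, (run w x, run w y, run w z) = reps i := by
  have step : ∀ s, (∃ w i, (run w (refl s x), run w (refl s y), run w (refl s z)) = reps i) →
      ∃ w i, (run w x, run w y, run w z) = reps i := fun s ⟨w, i, h⟩ => ⟨s :: w, i, h⟩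
  have ih : ∀ s, Prod.Lex (· < ·) (Prod.Lex (· < ·) (· < ·))
      ((15 - height (refl s x)).toNat, (15 - height (refl s y)).toNat,
        (15 - height (refl s z)).toNat)
      ((15 - height x).toNat, (15 - height y).toNat, (15 - height z).toNat) →
      ∃ w i, (run w x, run w y, run w z) = reps i := fun s hs =>
    step s <| exists_run_eq_reps (refl s x) (refl s y) (refl s z)
      (refl_mem_weights hx s) (refl_mem_weights hy s) (refl_mem_weights hz s)
      ((refl_injective s).ne hxy) ((refl_injective s).ne hxz) ((refl_injective s).ne hyz)
      (by rwa [dot_refl, dot_refl]) (by rwa [dot_refl, dot_refl])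
  rcases ascend_or_mem_reps x hx with ⟨s, h⟩ | h
  · have := height_le (refl_mem_weights hx s)
    exact ih s (Prod.Lex.left _ _ (by omega))
  rcases h y hy with ⟨s, hsx, h⟩ | h
  · have := height_le (refl_mem_weights hy s)
    refine ih s ?_
    rw [hsx]
    exact Prod.Lex.right _ (Prod.Lex.left _ _ (by omega))
  rcases h z hz with ⟨s, hsx, hsy, h⟩ | h
  · have := height_le (refl_mem_weights hz s)
    refine ih s ?_
    rw [hsx, hsy]
    exact Prod.Lex.right _ (Prod.Lex.right _ (by omega))
  exact ⟨[], by simpa [hxy, hxz, hyz, h₁, h₂] using h⟩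
termination_by ((15 - height x).toNat, (15 - height y).toNat, (15 - height z).toNat)
decreasing_by exact hs

lemma exists_image_run_eq (x y z : Vec) (hx : x ∈ weights) (hy : y ∈ weights)
    (hz : z ∈ weights) (hxy : x ≠ y) (hxz : x ≠ z) (hyz : y ≠ z) :
    ∃ w i, ({x, y, z} : Finset Vec).image (run w) = tripleSet (reps i) := by
  have sorted : ∀ a b c : Vec, ({a, b, c} : Finset Vec) = {x, y, z} → a ∈ weights → b ∈ weights →
      c ∈ weights → a ≠ b → a ≠ c → b ≠ c → dot a b ≤ dot a c → dot a c ≤ dot b c →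
      ∃ w i, ({x, y, z} : Finset Vec).image (run w) = tripleSet (reps i) := by
    intro a b c h ha hb hc hab hac hbc h₁ h₂
    obtain ⟨w, i, hw⟩ := exists_run_eq_reps a b c ha hb hc hab hac hbc h₁ h₂
    refine ⟨w, i, ?_⟩
    rw [← hw, ← h]
    simp [tripleSet, Finset.image_insert]
  have e₁ := dot_comm x y
  have e₂ := dot_comm x z
  have e₃ := dot_comm y z
  rcases le_total (dot x y) (dot x z) with h₁ | h₁ <;>
    rcases le_total (dot x z) (dot y z) with h₂ | h₂ <;>
    rcases le_total (dot x y) (dot y z) with h₃ | h₃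
  · exact sorted x y z rfl hx hy hz hxy hxz hyz h₁ h₂
  · exact sorted x y z rfl hx hy hz hxy hxz hyz h₁ h₂
  · exact sorted y x z (by grind) hy hx hz hxy.symm hyz hxz (by omega) (by omega)
  · exact sorted y z x (by grind) hy hz hx hyz hxy.symm hxz.symm (by omega) (by omega)
  · exact sorted x z y (by grind) hx hz hy hxz hxy hyz.symm (by omega) (by omega)
  · exact sorted z x y (by grind) hz hx hy hxz.symm hyz.symm hxy (by omega) (by omega)
  · exact sorted z y x (by grind) hz hy hx hyz.symm hxz.symm hxy.symm (by omega) (by omega)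
  · exact sorted z y x (by grind) hz hy hx hyz.symm hxz.symm hxy.symm (by omega) (by omega)

/-- An invariant of finite sets of weights. -/
def pairingSum (s : Finset Vec) : ℤ := ∑ x ∈ s, ∑ y ∈ s, (dot x y + 1) ^ 2

lemma pairingSum_image_run (w : List (Fin 6)) (s : Finset Vec) :
    pairingSum (s.image (run w)) = pairingSum s := by
  simp [pairingSum, Finset.sum_image (run_injective w).injOn, dot_run]

lemma pairingSum_reps_injective : Function.Injective fun i => pairingSum (tripleSet (reps i)) := by
  decide +kernel

lemma mem_weights_of_mem_reps {i : Fin 18} {x : Vec} (hx : x ∈ tripleSet (reps i)) :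
    x ∈ weights := by
  revert x i; decide +kernel

lemma card_tripleSet_reps (i : Fin 18) : (tripleSet (reps i)).card = 3 := by
  revert i; decide +kernel

/-! ### The orbits on `T⁽³⁾` -/

/-- Representatives of the orbits of `M` on `T⁽³⁾`. -/
def orbitRep (i : Fin 18) : T3 :=
  ⟨point '' (tripleSet (reps i) : Set Vec), by
    rw [Set.InjOn.ncard_image (point_injOn.mono fun _ => mem_weights_of_mem_reps),
      Set.ncard_coe_finset, card_tripleSet_reps]⟩

lemma op_eval_smul_image_point {s : Finset Vec} (hs : ∀ x ∈ s, x ∈ weights) (w : List (Fin 6)) :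
    MulOpposite.op (eval w) • (point '' (s : Set Vec)) =
      point '' ((s.image (run w) : Finset Vec) : Set Vec) := by
  rw [Finset.coe_image, Set.image_image, ← Set.image_smul, Set.image_image]
  exact Set.image_congr fun x hx => op_eval_smul_point (hs x hx) w

lemma eq_of_mem_orbit {i j : Fin 18}
    (h : orbitRep j ∈ MulAction.orbit (↥Mgp)ᵐᵒᵖ (orbitRep i)) : i = j := by
  obtain ⟨g, hg⟩ := h
  obtain ⟨w, hw⟩ := eval_surjective g.unop
  have h' : point '' ((tripleSet (reps i)).image (run w) : Finset Vec) =
      point '' (tripleSet (reps j) : Set Vec) := by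
    rw [← op_eval_smul_image_point fun _ => mem_weights_of_mem_reps, hw]
    exact congrArg Subtype.val hg
  have hset : (tripleSet (reps i)).image (run w) = tripleSet (reps j) := by
    refine Finset.coe_injective ((point_injOn.image_eq_image_iff ?_ ?_).mp h')
    · intro x hx
      obtain ⟨y, hy, rfl⟩ := Finset.mem_image.mp hx
      exact run_mem_weights (mem_weights_of_mem_reps hy) w
    · exact fun _ => mem_weights_of_mem_reps
  apply pairingSum_reps_injective
  change pairingSum _ = pairingSum _
  rw [← hset, pairingSum_image_run]

lemma exists_mem_orbit (q : T3) :
    ∃ i, q ∈ MulAction.orbit (↥Mgp)ᵐᵒᵖ (orbitRep i) := by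
  obtain ⟨a, b, c, hab, hac, hbc, hq⟩ := Set.ncard_eq_three.mp q.2
  obtain ⟨x, hx, rfl⟩ := exists_point_eq a
  obtain ⟨y, hy, rfl⟩ := exists_point_eq b
  obtain ⟨z, hz, rfl⟩ := exists_point_eq c
  obtain ⟨w, i, hw⟩ := exists_image_run_eq x y z hx hy hz (ne_of_apply_ne point hab)
    (ne_of_apply_ne point hac) (ne_of_apply_ne point hbc)
  refine ⟨i, MulAction.mem_orbit_symm.mp ⟨MulOpposite.op (eval w), Subtype.ext ?_⟩⟩
  change MulOpposite.op (eval w) • q.1 = point '' (tripleSet (reps i) : Set Vec)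
  rw [← hw, ← op_eval_smul_image_point (by simp [hx, hy, hz]), hq]
  simp [Set.image_insert_eq]

lemma kcount_smul (g : (↥Mgp)ᵐᵒᵖ) (s : T3) : kcount (g • s) = kcount s := by
  have h : g • Set.range (Sum.inl : RCK → Tspace) = Set.range Sum.inl := by
    ext t
    rw [Set.mem_smul_set_iff_inv_smul_mem]
    rcases t with t | t <;> simp
  change ((g • s.1) ∩ Set.range Sum.inl).ncard = (s.1 ∩ Set.range Sum.inl).ncard
  rw [← Set.ncard_smul_set g (s.1 ∩ Set.range Sum.inl), Set.smul_set_inter, h]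

lemma kcount_orbitRep (i : Fin 18) :
    kcount (orbitRep i) = ((tripleSet (reps i)).filter fun x => dot x x = 6).card := by
  have h : point '' (tripleSet (reps i) : Set Vec) ∩ Set.range Sum.inl =
      point '' ((tripleSet (reps i)).filter fun x => dot x x = 6 : Finset Vec) := by
    rw [← Set.image_inter_preimage, Finset.coe_filter]
    congr 1
    ext x
    by_cases hx : dot x x = 6 <;> simp [point, hx]
  rw [← Set.ncard_coe_finset, ← Set.InjOn.ncard_image (point_injOn.mono fun x hx =>
    mem_weights_of_mem_reps (Finset.mem_filter.mp hx).1), ← h]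
  rfl

/-- The action of `M` (acting on the right) on `T⁽³⁾` has exactly
eighteen orbits: 2 orbits of sets of three elements of `G_L\\M`, 4 orbits of sets with
one element of `G_K\\M` and two of `G_L\\M`, 7 orbits of sets with one element of
`G_L\\M` and two of `G_K\\M`, and 5 orbits of sets of three elements of `G_K\\M`. -/
theorem eighteen_orbits_on_T3 :
    ∃ p : Fin 18 → T3,
      (∀ i j : Fin 18, i ≠ j →
        MulAction.orbit (↥Mgp)ᵐᵒᵖ (p i) ≠ MulAction.orbit (↥Mgp)ᵐᵒᵖ (p j)) ∧
      (∀ q : T3, ∃ i : Fin 18, q ∈ MulAction.orbit (↥Mgp)ᵐᵒᵖ (p i)) ∧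
      (∀ i : Fin 18, ∀ q ∈ MulAction.orbit (↥Mgp)ᵐᵒᵖ (p i), kcount q = kcount (p i)) ∧
      (Finset.univ.filter fun i : Fin 18 => kcount (p i) = 0).card = 2 ∧
      (Finset.univ.filter fun i : Fin 18 => kcount (p i) = 1).card = 4 ∧
      (Finset.univ.filter fun i : Fin 18 => kcount (p i) = 2).card = 7 ∧
      (Finset.univ.filter fun i : Fin 18 => kcount (p i) = 3).card = 5 := by
  refine ⟨orbitRep, fun i j hij h => hij ?_, exists_mem_orbit, ?_, ?_⟩
  · exact eq_of_mem_orbit (h ▸ MulAction.mem_orbit_self (orbitRep j))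
  · rintro i _ ⟨g, rfl⟩
    exact kcount_smul g _
  · simp only [kcount_orbitRep]
    decide +kernel

end KLPaper
end
end
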